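/- arXiv:1803.09623 — 9 statements merged into one kernel-verified Lean document; each statement's English description precedes it below -/
import Mathlib

section
/- Let T be a rooted tree with root r having at least two children, and let e be an edge joining r to a child u_i that is not a leaf; let T_i be the branch rooted at u_i. Then 𝒫(T;x,y) = 𝒫(T/e;x,y) + y^{|T_i|−1}·𝒫(T∖T_i;x,y) − 2·y^{|T|−2} + y^{|T|−1}. -/
/-- A rooted tree: a root together with a list of branches. -/
inductive RTree : Type
  | node : List RTree → RTree

namespace RTree

/-- Number of vertices of a rooted tree. -/
def size : RTree → ℕ
  | node ts => 1 + (ts.attach.map fun t => t.1.size).sum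
decreasing_by
  have := List.sizeOf_lt_of_mem t.2
  simp only [node.sizeOf_spec]
  omega

/-- The Tutte-like polynomial `𝒫(T; x, y)`, evaluated at integers `x, y`. -/
def pol : RTree → ℤ → ℤ → ℤ
  | node ts, x, y =>
    if ts.isEmpty then x
    else (ts.attach.map fun t => pol t.1 x y).prod + y ^ ((node ts).size - 1)
decreasing_by
  have := List.sizeOf_lt_of_mem t.2
  simp only [node.sizeOf_spec]
  omega

/-- The subtree of `T` rooted at the vertex reached by following the path `p`
of child indices from the root, if such a vertex exists. -/
def subtree? : RTree → List ℕ → Option RTree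
  | t, [] => some t
  | node ts, i :: p => (ts[i]?).bind fun t => subtree? t p

/-- `p` is a vertex of `T` (vertices are identified with the paths of child
indices leading to them from the root). -/
def IsVertex (T : RTree) (p : List ℕ) : Prop := (T.subtree? p).isSome

end RTree

namespace RTree

theorem size_node (ts : List RTree) : (node ts).size = 1 + (ts.map size).sum := by
  rw [size, List.attach_map_val]

theorem pol_node {ts : List RTree} (hts : ts ≠ []) (x y : ℤ) :
    (node ts).pol x y = (ts.map fun t => t.pol x y).prod + y ^ (ts.map size).sum := by
  rw [pol, if_neg (by simpa using hts), size_node, Nat.add_sub_cancel_left]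
  exact congrArg (fun l : List ℤ => l.prod + y ^ (ts.map size).sum)
    (List.attach_map_val (l := ts) (f := fun t => t.pol x y))

end RTree

/-- Let `T` be a rooted tree whose root has at least two children,
and let `e` join the root to a child `uᵢ` that is not a leaf; the branch rooted at
`uᵢ` is `Tᵢ = RTree.node bs` with `bs ≠ []`, and the remaining branches are `ts ≠ []`.
Contracting `e` yields `RTree.node (bs ++ ts)` and deleting the branch `Tᵢ` yields
`RTree.node ts`.  Then
`𝒫(T;x,y) = 𝒫(T/e;x,y) + y^(|Tᵢ|−1)·𝒫(T∖Tᵢ;x,y) − 2·y^(|T|−2) + y^(|T|−1)`. -/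
theorem pol_delete_contract (bs ts : List RTree) (hbs : bs ≠ []) (hts : ts ≠ []) (x y : ℤ) :
    (RTree.node (RTree.node bs :: ts)).pol x y =
      (RTree.node (bs ++ ts)).pol x y
        + y ^ ((RTree.node bs).size - 1) * (RTree.node ts).pol x y
        - 2 * y ^ ((RTree.node (RTree.node bs :: ts)).size - 2)
        + y ^ ((RTree.node (RTree.node bs :: ts)).size - 1) := by
  have hsize : (RTree.node (RTree.node bs :: ts)).size
      = (bs.map RTree.size).sum + (ts.map RTree.size).sum + 2 := by
    rw [RTree.size_node, List.map_cons, List.sum_cons, RTree.size_node]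
    ring
  have hsum : (RTree.node bs).size + (ts.map RTree.size).sum
      = (bs.map RTree.size).sum + (ts.map RTree.size).sum + 1 := by
    rw [RTree.size_node]
    ring
  rw [hsize, RTree.pol_node (List.cons_ne_nil _ _), RTree.pol_node (by simp [hbs]),
    RTree.pol_node hts, List.map_cons, List.prod_cons, List.map_cons, List.sum_cons,
    RTree.pol_node hbs, hsum, RTree.size_node bs]
  simp only [List.map_append, List.prod_append, List.sum_append, Nat.add_sub_cancel_left,
    Nat.add_sub_cancel, Nat.add_succ_sub_one]
  ring
end

section
/- For every rooted tree T, 𝒫(T;1,1) equals the number of maximal antichains of T. -/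
namespace RTree

/-- `p` is a leaf of `T`: a vertex with no children. -/
def IsLeaf (T : RTree) (p : List ℕ) : Prop := T.subtree? p = some (node [])

/-- `A` is an antichain of `T`: a set of vertices no two of which lie on a common
path from the root, i.e. no element of `A` is an ancestor (= path-prefix) of
another. -/
def IsAntichainIn (T : RTree) (A : Finset (List ℕ)) : Prop :=
  (∀ p ∈ A, T.IsVertex p) ∧ ∀ p ∈ A, ∀ q ∈ A, p ≠ q → ¬ p <+: q

/-- `A` is a maximal antichain of `T`: an antichain that is not a proper subset of
another antichain. -/
def IsMaxAntichainIn (T : RTree) (A : Finset (List ℕ)) : Prop :=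
  T.IsAntichainIn A ∧ ∀ B : Finset (List ℕ), T.IsAntichainIn B → A ⊆ B → A = B

/-- `ℓ(A)`: the number of leaves of `T` contained in `A`. -/
noncomputable def leafCount (T : RTree) (A : Finset (List ℕ)) : ℕ :=
  {p ∈ (A : Set (List ℕ)) | T.IsLeaf p}.ncard

/-- The number of vertices of the subtree `T_p` of `T` rooted at the vertex `p`
(and `0` if `p` is not a vertex). -/
def subSize (T : RTree) (p : List ℕ) : ℕ := ((T.subtree? p).map size).getD 0

/-- `s(A) = ∑_{a ∈ A} (|T_a| − 1)`: the number of vertices strictly below `A`. -/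
def succCount (T : RTree) (A : Finset (List ℕ)) : ℕ := ∑ p ∈ A, (T.subSize p - 1)

end RTree

namespace RTree

theorem induction_on_branches {P : RTree → Prop}
    (h : ∀ ts : List RTree, (∀ t ∈ ts, P t) → P (node ts)) : ∀ T, P T
  | node ts => h ts fun t _ => induction_on_branches h t
decreasing_by
  have := List.sizeOf_lt_of_mem ‹t ∈ ts›
  simp only [node.sizeOf_spec]
  omega

theorem isVertex_nil (T : RTree) : T.IsVertex [] := by
  cases T
  simp [IsVertex, subtree?]

theorem isVertex_node_cons (ts : List RTree) (i : ℕ) (p : List ℕ) :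
    (node ts).IsVertex (i :: p) ↔ ∃ h : i < ts.length, ts[i].IsVertex p := by
  by_cases h : i < ts.length <;> simp [IsVertex, subtree?, h]

/-- An antichain is maximal if and only if every vertex is comparable to one of its elements. -/
theorem isMaxAntichainIn_iff (T : RTree) (A : Finset (List ℕ)) :
    T.IsMaxAntichainIn A ↔
      T.IsAntichainIn A ∧ ∀ v, T.IsVertex v → ∃ a ∈ A, a <+: v ∨ v <+: a := by
  classical
  refine and_congr_right fun hA => ⟨fun hmax v hv => ?_, fun hdom B hB hAB => ?_⟩
  · by_contra! hcon
    have hins : T.IsAntichainIn (insert v A) := by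
      refine ⟨fun p hp => ?_, fun p hp q hq hpq => ?_⟩
      · rcases Finset.mem_insert.1 hp with rfl | hp
        exacts [hv, hA.1 p hp]
      · rcases Finset.mem_insert.1 hp with rfl | hpA <;>
          rcases Finset.mem_insert.1 hq with rfl | hqA
        · exact absurd rfl hpq
        · exact (hcon q hqA).2
        · exact (hcon p hpA).1
        · exact hA.2 p hpA q hqA hpq
    have hvA : v ∈ A := by
      rw [hmax _ hins (Finset.subset_insert v A)]
      exact Finset.mem_insert_self v A
    exact (hcon v hvA).1 (List.prefix_refl v)
  · refine Finset.Subset.antisymm hAB fun v hv => ?_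
    obtain ⟨a, ha, hav⟩ := hdom v (hB.1 v hv)
    by_contra hvA
    have hne : a ≠ v := fun h => hvA (h ▸ ha)
    rcases hav with h | h
    · exact hB.2 a (hAB ha) v hv hne h
    · exact hB.2 v hv a (hAB ha) hne.symm h

/-- The part of a set of vertices lying in the `i`-th branch. -/
noncomputable def slice (A : Finset (List ℕ)) (i : ℕ) : Finset (List ℕ) :=
  A.preimage (List.cons i) List.cons_injective.injOn

theorem mem_slice {A : Finset (List ℕ)} {i : ℕ} {p : List ℕ} : p ∈ slice A i ↔ i :: p ∈ A := by
  simp [slice]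

/-- The union of sets of vertices of the individual branches. -/
def join {k : ℕ} (F : Fin k → Finset (List ℕ)) : Finset (List ℕ) :=
  Finset.univ.biUnion fun i => (F i).map ⟨List.cons i.1, List.cons_injective⟩

theorem nil_notMem_join {k : ℕ} (F : Fin k → Finset (List ℕ)) : [] ∉ join F := by
  simp [join]

theorem cons_mem_join {k : ℕ} {F : Fin k → Finset (List ℕ)} {i : ℕ} {p : List ℕ} :
    i :: p ∈ join F ↔ ∃ h : i < k, p ∈ F ⟨i, h⟩ := by
  simp only [join, Finset.mem_biUnion, Finset.mem_univ, true_and, Finset.mem_map,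
    Function.Embedding.coeFn_mk, List.cons.injEq]
  constructor
  · rintro ⟨j, q, hq, rfl, rfl⟩
    exact ⟨j.2, hq⟩
  · rintro ⟨h, hp⟩
    exact ⟨⟨i, h⟩, p, hp, rfl, rfl⟩

theorem slice_join {k : ℕ} (F : Fin k → Finset (List ℕ)) (i : Fin k) : slice (join F) i = F i := by
  ext p
  simp [mem_slice, cons_mem_join]

theorem join_injective {k : ℕ} : Function.Injective (join (k := k)) := fun F G h => by
  funext i
  rw [← slice_join F, h, slice_join]

theorem isMaxAntichainIn_singleton_nil (T : RTree) : T.IsMaxAntichainIn {[]} := by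
  rw [isMaxAntichainIn_iff]
  refine ⟨⟨by simpa using T.isVertex_nil, by simp⟩, by simp⟩

theorem IsMaxAntichainIn.eq_singleton_nil {T : RTree} {A : Finset (List ℕ)}
    (hA : T.IsMaxAntichainIn A) (h : [] ∈ A) : A = {[]} :=
  (Finset.eq_singleton_iff_unique_mem.2 ⟨h, fun p hp => by
    by_contra hne
    exact hA.1.2 [] h p hp (Ne.symm hne) List.nil_prefix⟩)

theorem isMaxAntichainIn_node_iff {ts : List RTree} (hts : ts ≠ []) {A : Finset (List ℕ)}
    (hA : [] ∉ A) :
    (node ts).IsMaxAntichainIn A ↔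
      (∀ i p, i :: p ∈ A → i < ts.length) ∧
        ∀ i : Fin ts.length, ts[i].IsMaxAntichainIn (slice A i) := by
  simp only [isMaxAntichainIn_iff]
  constructor
  · rintro ⟨⟨hv, hanti⟩, hdom⟩
    refine ⟨fun i p hp => ((isVertex_node_cons ts i p).1 (hv _ hp)).1,
      fun i => ⟨⟨fun p hp => ?_, fun p hp q hq hpq hpre => ?_⟩, fun v hvert => ?_⟩⟩
    · exact ((isVertex_node_cons ts i p).1 (hv _ (mem_slice.1 hp))).2
    · exact hanti _ (mem_slice.1 hp) _ (mem_slice.1 hq) (by simpa using hpq)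
        (by simpa [List.cons_prefix_cons] using hpre)
    · obtain ⟨a, ha, hc⟩ := hdom (i.1 :: v) ((isVertex_node_cons ts i v).2 ⟨i.2, hvert⟩)
      cases a with
      | nil => exact absurd ha hA
      | cons j a =>
        simp only [List.cons_prefix_cons] at hc
        obtain rfl : j = i.1 := by rcases hc with h | h <;> simp [h.1]
        exact ⟨a, mem_slice.2 ha, by simpa using hc⟩
  · rintro ⟨hlt, hbr⟩
    refine ⟨⟨fun p hp => ?_, fun p hp q hq hpq hpre => ?_⟩, fun v hvert => ?_⟩
    · cases p with
      | nil => exact absurd hp hA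
      | cons i p =>
        exact (isVertex_node_cons ts i p).2
          ⟨hlt i p hp, (hbr ⟨i, hlt i p hp⟩).1.1 p (mem_slice.2 hp)⟩
    · cases p with
      | nil => exact absurd hp hA
      | cons i p =>
        cases q with
        | nil => exact absurd hq hA
        | cons j q =>
          obtain ⟨rfl, hpre'⟩ := List.cons_prefix_cons.1 hpre
          exact (hbr ⟨i, hlt i p hp⟩).1.2 p (mem_slice.2 hp) q (mem_slice.2 hq)
            (by simpa using hpq) hpre'
    · cases v with
      | nil =>
        obtain ⟨a, ha, -⟩ := (hbr ⟨0, List.length_pos_of_ne_nil hts⟩).2 [] (isVertex_nil _)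
        exact ⟨_, mem_slice.1 ha, Or.inr List.nil_prefix⟩
      | cons i v =>
        obtain ⟨hi, hv⟩ := (isVertex_node_cons ts i v).1 hvert
        obtain ⟨a, ha, hc⟩ := (hbr ⟨i, hi⟩).2 v hv
        exact ⟨_, mem_slice.1 ha, by simpa [List.cons_prefix_cons] using hc⟩

theorem setOf_isMaxAntichainIn_nil : {A | (node []).IsMaxAntichainIn A} = {{[]}} := by
  ext A
  simp only [Set.mem_ofPred_eq, Set.mem_singleton_iff]
  refine ⟨fun hA => ?_, fun h => h ▸ isMaxAntichainIn_singleton_nil _⟩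
  obtain ⟨a, ha, -⟩ := ((isMaxAntichainIn_iff _ _).1 hA).2 [] (isVertex_nil _)
  cases a with
  | nil => exact hA.eq_singleton_nil ha
  | cons i a => simpa [isVertex_node_cons] using hA.1.1 _ ha

/-- A maximal antichain of a tree with at least one branch is either the root alone or a union of
maximal antichains of the branches. -/
theorem setOf_isMaxAntichainIn_node {ts : List RTree} (hts : ts ≠ []) :
    {A | (node ts).IsMaxAntichainIn A} =
      insert {[]} (join '' Set.univ.pi fun i : Fin ts.length => {A | ts[i].IsMaxAntichainIn A}) := by
  ext A
  simp only [Set.mem_ofPred_eq, Set.mem_insert_iff, Set.mem_image, Set.mem_univ_pi]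
  constructor
  · intro hA
    by_cases hnil : [] ∈ A
    · exact Or.inl (hA.eq_singleton_nil hnil)
    · obtain ⟨hlt, hbr⟩ := (isMaxAntichainIn_node_iff hts hnil).1 hA
      refine Or.inr ⟨fun i => slice A i, hbr, ?_⟩
      ext p
      cases p with
      | nil => simp [hnil, nil_notMem_join]
      | cons i p =>
        simp only [cons_mem_join, mem_slice, exists_prop, and_iff_right_iff_imp]
        exact hlt i p
  · rintro (rfl | ⟨F, hF, rfl⟩)
    · exact isMaxAntichainIn_singleton_nil _
    · refine (isMaxAntichainIn_node_iff hts (nil_notMem_join F)).2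
        ⟨fun i p hp => (cons_mem_join.1 hp).1, fun i => ?_⟩
      rw [slice_join]
      exact hF i

theorem finite_setOf_isMaxAntichainIn (T : RTree) : {A | T.IsMaxAntichainIn A}.Finite := by
  induction T using induction_on_branches with
  | h ts ih =>
    rcases eq_or_ne ts [] with rfl | hts
    · simp [setOf_isMaxAntichainIn_nil]
    · rw [setOf_isMaxAntichainIn_node hts]
      exact ((Set.Finite.pi fun i => ih _ (List.getElem_mem i.2)).image _).insert _

theorem ncard_setOf_isMaxAntichainIn_node {ts : List RTree} (hts : ts ≠ []) :
    {A | (node ts).IsMaxAntichainIn A}.ncard =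
      (∏ i : Fin ts.length, {A | ts[i].IsMaxAntichainIn A}.ncard) + 1 := by
  have hfin := (Set.Finite.pi fun i : Fin ts.length => finite_setOf_isMaxAntichainIn ts[i]).image join
  rw [setOf_isMaxAntichainIn_node hts, Set.ncard_insert_of_notMem _ hfin,
    Set.ncard_image_of_injective _ join_injective]
  · congr 1
    simp only [← Nat.card_coe_set_eq]
    rw [← Nat.card_pi]
    exact Nat.card_congr (Equiv.Set.univPi _)
  · rintro ⟨F, -, hF⟩
    exact nil_notMem_join F (by simp [hF])

theorem pol_node_one_one {ts : List RTree} (hts : ts ≠ []) :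
    (node ts).pol 1 1 = (∏ i : Fin ts.length, ts[i].pol 1 1) + 1 := by
  rw [pol]
  simp only [List.isEmpty_iff, hts, if_false, one_pow]
  congr 1
  rw [← List.prod_ofFn]
  congr 1
  apply List.ext_getElem <;> simp

end RTree

/-- For every rooted tree `T`, `𝒫(T;1,1)` equals the number of
maximal antichains of `T`. -/
theorem pol_one_one (T : RTree) :
    T.pol 1 1 = {A : Finset (List ℕ) | T.IsMaxAntichainIn A}.ncard := by
  induction T using RTree.induction_on_branches with
  | h ts ih =>
    rcases eq_or_ne ts [] with rfl | hts
    · simp [RTree.setOf_isMaxAntichainIn_nil, RTree.pol]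
    · rw [RTree.pol_node_one_one hts, RTree.ncard_setOf_isMaxAntichainIn_node hts]
      push_cast
      congr 1
      exact Finset.prod_congr rfl fun i _ => ih _ (List.getElem_mem i.2)
end

section
/- Let P be a nonempty 𝒱-poset and let P∪{g} be the poset obtained by adding a new greatest element g to P. Then g is not a basic element of P∪{g}, and an element of P is basic in P∪{g} if and only if it is basic in P. -/
/-- The order relation of the disjoint union of two ordered sets. -/
def sumRel {α β : Type} (r : α → α → Prop) (s : β → β → Prop) :
    α ⊕ β → α ⊕ β → Prop
  | Sum.inl a, Sum.inl a' => r a a'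
  | Sum.inr b, Sum.inr b' => s b b'
  | _, _ => False

/-- The order relation obtained from `r` by adding a new greatest element
(represented by `none`). -/
def addTopRel {α : Type} (r : α → α → Prop) : Option α → Option α → Prop
  | _, none => True
  | none, some _ => False
  | some a, some b => r a b

/-- The order relation obtained from `r` by adding a new least element
(represented by `none`). -/
def addBotRel {α : Type} (r : α → α → Prop) : Option α → Option α → Prop
  | none, _ => True
  | some _, none => False
  | some a, some b => r a b

/-- The relations (on arbitrary carrier types) that arise from the empty order by
repeatedly taking disjoint unions and adding a new greatest or least element;
the class is closed under relabelling along bijections. -/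
inductive IsVRel : (α : Type) → (α → α → Prop) → Prop
  | empty (α : Type) (r : α → α → Prop) (h : IsEmpty α) : IsVRel α r
  | union {α β : Type} {r : α → α → Prop} {s : β → β → Prop} :
      IsVRel α r → IsVRel β s → IsVRel (α ⊕ β) (sumRel r s)
  | addTop {α : Type} {r : α → α → Prop} : IsVRel α r → IsVRel (Option α) (addTopRel r)
  | addBot {α : Type} {r : α → α → Prop} : IsVRel α r → IsVRel (Option α) (addBotRel r)
  | congr {α β : Type} {r : α → α → Prop} {s : β → β → Prop} (e : α ≃ β)
      (he : ∀ a b : α, r a b ↔ s (e a) (e b)) : IsVRel α r → IsVRel β s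

/-- A partially ordered set is a `𝒱`-poset if it can be built from the empty poset
by repeatedly taking disjoint unions and adding new greatest or least elements. -/
def IsVPoset (α : Type) [PartialOrder α] : Prop :=
  IsVRel α (· ≤ ·)

section Basic

variable {α : Type} [PartialOrder α]

/-- Two elements of a poset are incomparable. -/
def Incomp (u v : α) : Prop := ¬(u ≤ v ∨ v ≤ u)

/-- An element `x` of a poset is basic if (B1) there are no two incomparable
elements `u, v` with `x > u` and `x > v`; (B2) there are no two incomparable
elements `u, v` with `x < u` and `x < v`; and (B3) there is no `u < x` such that
every element `w ≠ u, x` satisfies `(u ≥ w ↔ x ≥ w)` and `(u ≤ w ↔ x ≤ w)`. -/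
def IsBasic (x : α) : Prop :=
  (¬∃ u v : α, Incomp u v ∧ u < x ∧ v < x) ∧
  (¬∃ u v : α, Incomp u v ∧ x < u ∧ x < v) ∧
  ¬∃ u : α, u < x ∧ ∀ w : α, w ≠ u → w ≠ x →
    ((w ≤ u ↔ w ≤ x) ∧ (u ≤ w ↔ x ≤ w))

end Basic

section WithTopLemmas

variable {α : Type} [PartialOrder α]

theorem incomp_coe_withTop {u v : α} : Incomp (u : WithTop α) (v : WithTop α) ↔ Incomp u v := by
  simp [Incomp]

theorem not_incomp_top_left (v : WithTop α) : ¬Incomp ⊤ v := fun h => h (Or.inr le_top)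

theorem not_incomp_top_right (u : WithTop α) : ¬Incomp u ⊤ := fun h => h (Or.inl le_top)

/-- In a finite nonempty order, a new greatest element is never basic: either two elements
below it are incomparable, or the order is a chain and the maximum of the chain
violates (B3). -/
theorem not_isBasic_top [Finite α] [Nonempty α] : ¬IsBasic (⊤ : WithTop α) := by
  rintro ⟨h₁, -, h₃⟩
  have total : ∀ u v : α, u ≤ v ∨ v ≤ u := fun u v => by
    by_contra huv
    exact h₁ ⟨u, v, incomp_coe_withTop.2 huv, WithTop.coe_lt_top u, WithTop.coe_lt_top v⟩
  obtain ⟨m, hm⟩ := Set.finite_univ.exists_maximal (Set.univ_nonempty (α := α))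
  have hle : ∀ w : α, w ≤ m := fun w => (total w m).elim id (hm.le_of_ge (Set.mem_univ w))
  refine h₃ ⟨m, WithTop.coe_lt_top m, fun w hwm hwt => ?_⟩
  lift w to α using hwt
  have hmw : ¬m ≤ w := fun h => hwm (congrArg _ ((hle w).antisymm h))
  simp [hle, hmw]

/-- Adding a greatest element does not change which of the old elements are basic. -/
theorem isBasic_coe_withTop (a : α) : IsBasic (a : WithTop α) ↔ IsBasic a := by
  simp [IsBasic, WithTop.exists, WithTop.forall, incomp_coe_withTop, not_incomp_top_left,
    not_incomp_top_right]

end WithTopLemmas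

/-- Let `P` be a nonempty (finite) `𝒱`-poset and let `P ∪ {g}`
be obtained from `P` by adding a new greatest element `g` (modelled as
`⊤ : WithTop α`).  Then `g` is not basic in `P ∪ {g}`, and an element of `P` is
basic in `P ∪ {g}` if and only if it is basic in `P`. -/
theorem isBasic_withTop (α : Type) [PartialOrder α] [Fintype α] [Nonempty α]
    (h : IsVPoset α) :
    ¬IsBasic (⊤ : WithTop α) ∧ ∀ a : α, IsBasic (a : WithTop α) ↔ IsBasic a := by
  exact ⟨not_isBasic_top, isBasic_coe_withTop⟩
end

section
/- Let P be a 𝒱-poset that is not linearly ordered, and let P∪{ℓ} be the poset obtained by adding a new least element ℓ to P. Then ℓ is not a basic element of P∪{ℓ}, and an element of P is basic in P∪{ℓ} if and only if it is basic in P. -/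
section WithBot

variable {α : Type} [PartialOrder α]

theorem incomp_withBot_iff (u v : WithBot α) :
    Incomp u v ↔ ∃ a b : α, u = a ∧ v = b ∧ Incomp a b := by
  induction u <;> induction v <;> simp [Incomp]

theorem exists_incomp_withBot_iff (p : WithBot α → Prop) :
    (∃ u v : WithBot α, Incomp u v ∧ p u ∧ p v) ↔ ∃ u v : α, Incomp u v ∧ p u ∧ p v := by
  constructor
  · rintro ⟨u, v, h, hu, hv⟩
    obtain ⟨a, b, rfl, rfl, hab⟩ := (incomp_withBot_iff u v).1 h
    exact ⟨a, b, hab, hu, hv⟩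
  · rintro ⟨a, b, h, ha, hb⟩
    exact ⟨a, b, (incomp_withBot_iff _ _).2 ⟨a, b, rfl, rfl, h⟩, ha, hb⟩

end WithBot

/-- Let `P` be a (finite) `𝒱`-poset that is not linearly
ordered, and let `P ∪ {ℓ}` be obtained from `P` by adding a new least element `ℓ`
(modelled as `⊥ : WithBot α`).  Then `ℓ` is not basic in `P ∪ {ℓ}`, and an element
of `P` is basic in `P ∪ {ℓ}` if and only if it is basic in `P`. -/
theorem isBasic_withBot (α : Type) [PartialOrder α] [Fintype α]
    (h : IsVPoset α) (hnl : ¬∀ a b : α, a ≤ b ∨ b ≤ a) :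
    ¬IsBasic (⊥ : WithBot α) ∧ ∀ a : α, IsBasic (a : WithBot α) ↔ IsBasic a := by
  simp only [not_forall] at hnl
  obtain ⟨b, c, hbc⟩ := hnl
  refine ⟨fun hb => hb.2.1 ((exists_incomp_withBot_iff _).2
    ⟨b, c, hbc, WithBot.bot_lt_coe b, WithBot.bot_lt_coe c⟩), fun a => ?_⟩
  unfold IsBasic
  rw [exists_incomp_withBot_iff (· < (a : WithBot α)),
    exists_incomp_withBot_iff ((a : WithBot α) < ·)]
  simp only [WithBot.coe_lt_coe]
  refine and_congr_right fun _ => and_congr_right fun h2 => not_congr ⟨?_, ?_⟩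
  · rintro ⟨u, hu, hw⟩
    induction u with
    | bot =>
      have hle : ∀ w : α, a ≤ w := fun w => by
        rcases eq_or_ne w a with rfl | hwa
        · exact le_rfl
        · exact WithBot.coe_le_coe.1 <|
            (hw w WithBot.coe_ne_bot (WithBot.coe_injective.ne hwa)).2.1 bot_le
      refine (h2 ⟨b, c, hbc, (hle b).lt_of_ne ?_, (hle c).lt_of_ne ?_⟩).elim
      · rintro rfl
        exact hbc (Or.inl (hle c))
      · rintro rfl
        exact hbc (Or.inr (hle b))
    | coe u =>
      refine ⟨u, WithBot.coe_lt_coe.1 hu, fun w hwu hwa => ?_⟩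
      simpa only [WithBot.coe_le_coe] using
        hw w (WithBot.coe_injective.ne hwu) (WithBot.coe_injective.ne hwa)
  · rintro ⟨u, hu, hw⟩
    refine ⟨u, WithBot.coe_lt_coe.2 hu, fun w hwu hwa => ?_⟩
    induction w with
    | bot => simp
    | coe w =>
      simpa only [WithBot.coe_le_coe] using
        hw w (ne_of_apply_ne _ hwu) (ne_of_apply_ne _ hwa)
end

section
/- Let P be a finite poset whose Hasse diagram is a rooted tree. (1) If the root is the greatest element of P, then the basic elements of P are exactly the minimal elements of P (the leaves of the tree). (2) If the root is the least element of P, then the basic elements of P are exactly the minimal elements of the induced subposet P_1 = {x ∈ P : there is exactly one maximal element m of P with x ≤ m}. -/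
/-- An element `x` is not basic if it covers some `u` such that every element above `u` is
comparable with `x` and every element below `x` is comparable with `u`. -/
lemma CovBy.not_isBasic {α : Type} [PartialOrder α] {u x : α} (h : u ⋖ x)
    (hup : ∀ w, u ≤ w → w ≤ x ∨ x ≤ w) (hdown : ∀ w, w ≤ x → w ≤ u ∨ u ≤ w) :
    ¬IsBasic x := by
  rintro ⟨-, -, hB⟩
  have between : ∀ w, u ≤ w → w ≤ x → w ≠ u → w ≠ x → False := fun w h1 h2 h3 h4 =>
    h.2 (lt_of_le_of_ne h1 h3.symm) (lt_of_le_of_ne h2 h4)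
  refine hB ⟨u, h.1, fun w hwu hwx => ⟨⟨fun hw => hw.trans h.1.le, fun hw => ?_⟩,
    ⟨fun hw => ?_, fun hw => h.1.le.trans hw⟩⟩⟩
  · exact (hdown w hw).resolve_right fun h' => between w h' hw hwu hwx
  · exact (hup w hw).resolve_left fun h' => between w hw h' hwu hwx

lemma IsMin.isBasic {α : Type} [PartialOrder α] {x : α} (hx : IsMin x)
    (hchain : ∀ a b : α, x ≤ a → x ≤ b → a ≤ b ∨ b ≤ a) : IsBasic x := by
  refine ⟨?_, ?_, ?_⟩
  · rintro ⟨u, v, -, hu, -⟩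
    exact hx.not_lt hu
  · rintro ⟨u, v, huv, hu, hv⟩
    exact huv (hchain u v hu.le hv.le)
  · rintro ⟨u, hu, -⟩
    exact hx.not_lt hu

lemma IsBasic.isMin {α : Type} [PartialOrder α] [Finite α] {x : α} (hx : IsBasic x)
    (hchain : ∀ y a b : α, y ≤ a → y ≤ b → a ≤ b ∨ b ≤ a) : IsMin x := by
  by_contra hmin
  obtain ⟨y, hy⟩ := not_isMin_iff.mp hmin
  obtain ⟨u, -, hu⟩ := exists_le_covBy_of_lt hy
  refine hu.not_isBasic (fun w hw => hchain u w x hw hu.le) (fun w hw => ?_) hx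
  rcases eq_or_lt_of_le hw with rfl | hw
  · exact Or.inr hu.le
  · by_contra hinc
    exact hx.1 ⟨w, u, hinc, hw, hu.1⟩

lemma exists_isMax_ge {α : Type} [PartialOrder α] [Finite α] (x : α) :
    ∃ m, IsMax m ∧ x ≤ m := by
  obtain ⟨m, hxm, hm⟩ := Set.toFinite (Set.univ : Set α) |>.exists_le_maximal (Set.mem_univ x)
  exact ⟨m, fun y hy => hm.2 (Set.mem_univ y) hy, hxm⟩

lemma IsBasic.existsUnique_isMax {α : Type} [PartialOrder α] [Finite α] {x : α}
    (hx : IsBasic x) : ∃! m : α, IsMax m ∧ x ≤ m := by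
  obtain ⟨m, hm, hxm⟩ := exists_isMax_ge x
  refine ⟨m, ⟨hm, hxm⟩, fun n ⟨hn, hxn⟩ => ?_⟩
  rcases eq_or_lt_of_le hxm with rfl | hlt
  · exact hm.eq_of_ge hxn
  rcases eq_or_lt_of_le hxn with rfl | hlt'
  · exact hn.eq_of_le hxm
  by_contra hne
  exact hx.2.1 ⟨m, n, fun h => h.elim (fun h => hne (hm.eq_of_le h).symm)
    (fun h => hne (hn.eq_of_le h)), hlt, hlt'⟩

/-- If the lower sets of elements are chains, then so is the set of elements above an
element that lies below a unique maximal element. -/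
lemma le_total_of_existsUnique_isMax {α : Type} [PartialOrder α] [Finite α]
    (hchain : ∀ y a b : α, a ≤ y → b ≤ y → a ≤ b ∨ b ≤ a) {x : α}
    (hx : ∃! m : α, IsMax m ∧ x ≤ m) {a b : α} (ha : x ≤ a) (hb : x ≤ b) :
    a ≤ b ∨ b ≤ a := by
  obtain ⟨m, hm, ham⟩ := exists_isMax_ge a
  obtain ⟨n, hn, hbn⟩ := exists_isMax_ge b
  obtain rfl := hx.unique ⟨hm, ha.trans ham⟩ ⟨hn, hb.trans hbn⟩
  exact hchain m a b ham hbn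

lemma IsBasic.eq_of_existsUnique_isMax {α : Type} [PartialOrder α] [Finite α]
    (hchain : ∀ y a b : α, a ≤ y → b ≤ y → a ≤ b ∨ b ≤ a) {x z : α} (hx : IsBasic x)
    (hz : ∃! m : α, IsMax m ∧ z ≤ m) (hzx : z ≤ x) : z = x := by
  by_contra hne
  obtain ⟨u, hzu, hu⟩ := exists_le_covBy_of_lt (lt_of_le_of_ne hzx hne)
  exact hu.not_isBasic
    (fun w hw => le_total_of_existsUnique_isMax hchain hz (hzu.trans hw) hzx)
    (fun w hw => hchain x w u hw hu.le) hx

lemma isBasic_of_existsUnique_isMax {α : Type} [PartialOrder α] [Finite α]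
    (hchain : ∀ y a b : α, a ≤ y → b ≤ y → a ≤ b ∨ b ≤ a) {x : α}
    (hx : ∃! m : α, IsMax m ∧ x ≤ m)
    (hmin : ∀ z : α, (∃! m : α, IsMax m ∧ z ≤ m) → z ≤ x → z = x) : IsBasic x := by
  refine ⟨?_, ?_, ?_⟩
  · rintro ⟨u, v, huv, hu, hv⟩
    exact huv (hchain x u v hu.le hv.le)
  · rintro ⟨u, v, huv, hu, hv⟩
    exact huv (le_total_of_existsUnique_isMax hchain hx hu.le hv.le)
  · rintro ⟨u, hu, htwin⟩
    obtain ⟨m, ⟨hm, hxm⟩, huniq⟩ := hx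
    refine hu.ne (hmin u ⟨m, ⟨hm, hu.le.trans hxm⟩, fun n ⟨hn, hun⟩ => huniq n ⟨hn, ?_⟩⟩ hu.le)
    rcases eq_or_ne n x with rfl | hnx
    · exact le_rfl
    have hnu : n ≠ u := by
      rintro rfl
      exact hn.not_lt hu
    exact (htwin n hnu hnx).2.mp hun

/-- Let `P` be a finite poset whose Hasse diagram is a rooted
tree.
(1) If the root is the greatest element of `P` (equivalently: `P` has a greatest
element and the up-set of every element is a chain), then the basic elements of
`P` are exactly the minimal elements of `P` (the leaves of the tree).
(2) If the root is the least element of `P` (equivalently: `P` has a least element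
and the down-set of every element is a chain), then the basic elements of `P` are
exactly the minimal elements of the induced subposet
`P₁ = {x ∈ P : there is exactly one maximal element m of P with x ≤ m}`
(the maximal elements being the leaves of the tree). -/
theorem isBasic_tree_poset (α : Type) [PartialOrder α] [Fintype α] :
    ((∃ g : α, ∀ x : α, x ≤ g) → (∀ x a b : α, x ≤ a → x ≤ b → a ≤ b ∨ b ≤ a) →
      ∀ x : α, IsBasic x ↔ IsMin x) ∧
    ((∃ ℓ : α, ∀ x : α, ℓ ≤ x) → (∀ x a b : α, a ≤ x → b ≤ x → a ≤ b ∨ b ≤ a) →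
      ∀ x : α, IsBasic x ↔
        (x ∈ {z : α | ∃! m : α, IsMax m ∧ z ≤ m} ∧
          ∀ z ∈ {z : α | ∃! m : α, IsMax m ∧ z ≤ m}, z ≤ x → z = x)) := by
  refine ⟨fun _ hchain x => ⟨fun hx => hx.isMin hchain, fun hx => hx.isBasic (hchain x)⟩,
    fun _ hchain x => ⟨fun hx => ⟨hx.existsUnique_isMax, fun z hz hzx =>
      hx.eq_of_existsUnique_isMax hchain hz hzx⟩, fun hx =>
      isBasic_of_existsUnique_isMax hchain hx.1 hx.2⟩⟩
end

section
/- In every nonempty 𝒱-poset, every non-basic element is comparable to at least one basic element. -/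
/-- The notion `IsBasic` for an arbitrary relation `r`, read as a non-strict order. -/
def RelBasic {α : Type} (r : α → α → Prop) (x : α) : Prop :=
  (∀ u v : α, r u x → ¬r x u → r v x → ¬r x v → r u v ∨ r v u) ∧
  (∀ u v : α, r x u → ¬r u x → r x v → ¬r v x → r u v ∨ r v u) ∧
  ∀ u : α, r u x → ¬r x u → ∃ w : α, w ≠ u ∧ w ≠ x ∧ ¬((r w u ↔ r w x) ∧ (r u w ↔ r x w))

theorem isBasic_iff_relBasic {α : Type} [PartialOrder α] (x : α) :
    IsBasic x ↔ RelBasic (· ≤ ·) x := by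
  unfold IsBasic RelBasic Incomp
  simp only [lt_iff_le_not_ge]
  push Not
  refine and_congr ?_ (and_congr ?_ ?_) <;> grind

theorem RelBasic.inl {α β : Type} {r : α → α → Prop} {s : β → β → Prop} {x : α}
    (h : RelBasic r x) : RelBasic (sumRel r s) (Sum.inl x) := by
  obtain ⟨h₁, h₂, h₃⟩ := h
  refine ⟨?_, ?_, ?_⟩
  · rintro (u | u) (v | v) <;> simp only [sumRel] <;> grind
  · rintro (u | u) (v | v) <;> simp only [sumRel] <;> grind
  · rintro (u | u) hu hu'
    · obtain ⟨w, hw⟩ := h₃ u hu hu'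
      exact ⟨Sum.inl w, by simpa [sumRel] using hw⟩
    · exact hu.elim

theorem RelBasic.inr {α β : Type} {r : α → α → Prop} {s : β → β → Prop} {x : β}
    (h : RelBasic s x) : RelBasic (sumRel r s) (Sum.inr x) := by
  obtain ⟨h₁, h₂, h₃⟩ := h
  refine ⟨?_, ?_, ?_⟩
  · rintro (u | u) (v | v) <;> simp only [sumRel] <;> grind
  · rintro (u | u) (v | v) <;> simp only [sumRel] <;> grind
  · rintro (u | u) hu hu'
    · exact hu.elim
    · obtain ⟨w, hw⟩ := h₃ u hu hu'
      exact ⟨Sum.inr w, by simpa [sumRel] using hw⟩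

theorem RelBasic.some_addTop {α : Type} {r : α → α → Prop} {x : α}
    (h : RelBasic r x) : RelBasic (addTopRel r) (some x) := by
  obtain ⟨h₁, h₂, h₃⟩ := h
  refine ⟨?_, ?_, ?_⟩
  · rintro (_ | u) (_ | v) <;> simp only [addTopRel] <;> grind
  · rintro (_ | u) (_ | v) <;> simp only [addTopRel] <;> grind
  · rintro (_ | u) hu hu'
    · exact hu.elim
    · obtain ⟨w, hw⟩ := h₃ u hu hu'
      exact ⟨some w, by simpa [addTopRel] using hw⟩

theorem RelBasic.some_addBot {α : Type} {r : α → α → Prop} {x : α} (h : RelBasic r x)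
    (hx : ∃ w, w ≠ x ∧ (r w x ∨ ¬r x w)) : RelBasic (addBotRel r) (some x) := by
  obtain ⟨h₁, h₂, h₃⟩ := h
  refine ⟨?_, ?_, ?_⟩
  · rintro (_ | u) (_ | v) <;> simp only [addBotRel] <;> grind
  · rintro (_ | u) (_ | v) <;> simp only [addBotRel] <;> grind
  · rintro (_ | u) hu hu'
    · obtain ⟨w, hwx, hw⟩ := hx
      refine ⟨some w, by simp, by simpa using hwx, ?_⟩
      simp only [addBotRel]
      tauto
    · obtain ⟨w, hw⟩ := h₃ u hu hu'
      exact ⟨some w, by simpa [addBotRel] using hw⟩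

theorem relBasic_none_addBot {α : Type} {r : α → α → Prop} (h : ∀ u v, r u v ∨ r v u) :
    RelBasic (addBotRel r) none := by
  refine ⟨?_, ?_, ?_⟩
  · rintro (_ | u) (_ | v) <;> simp [addBotRel]
  · rintro (_ | u) (_ | v) <;> simp [addBotRel, h]
  · rintro (_ | u) <;> simp [addBotRel]

theorem relBasic_none_addTop {α : Type} {r : α → α → Prop} (h : IsEmpty α) :
    RelBasic (addTopRel r) none := by
  refine ⟨?_, ?_, ?_⟩
  · rintro (_ | u)
    · simp [addTopRel]
    · exact h.elim u
  · rintro (_ | u) (_ | v) <;> simp [addTopRel]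
  · rintro (_ | u) <;> [simp [addTopRel]; exact h.elim u]

theorem RelBasic.map {α β : Type} {r : α → α → Prop} {s : β → β → Prop} (e : α ≃ β)
    (he : ∀ a b : α, r a b ↔ s (e a) (e b)) {x : α} (h : RelBasic r x) :
    RelBasic s (e x) := by
  simpa only [RelBasic, he, e.forall_congr_left, e.exists_congr_left, ne_eq,
    e.symm_apply_eq, e.apply_symm_apply] using h

/-- Every element of a `𝒱`-relation is comparable to a basic element. -/
theorem IsVRel.exists_relBasic {α : Type} {r : α → α → Prop} (h : IsVRel α r) :
    (∀ x, r x x) ∧ ∀ x, ∃ b, RelBasic r b ∧ (r b x ∨ r x b) := by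
  induction h with
  | empty α r h => exact ⟨fun x => h.elim x, fun x => h.elim x⟩
  | union _ _ ih₁ ih₂ =>
    refine ⟨?_, ?_⟩
    · rintro (x | x)
      exacts [ih₁.1 x, ih₂.1 x]
    · rintro (x | x)
      · obtain ⟨b, hb, hbx⟩ := ih₁.2 x
        exact ⟨Sum.inl b, hb.inl, hbx⟩
      · obtain ⟨b, hb, hbx⟩ := ih₂.2 x
        exact ⟨Sum.inr b, hb.inr, hbx⟩
  | @addTop α r _ ih =>
    refine ⟨?_, ?_⟩
    · rintro (_ | x)
      exacts [trivial, ih.1 x]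
    · rintro (_ | x)
      · rcases isEmpty_or_nonempty α with hα | ⟨⟨a⟩⟩
        · exact ⟨none, relBasic_none_addTop hα, Or.inl trivial⟩
        · obtain ⟨b, hb, -⟩ := ih.2 a
          exact ⟨some b, hb.some_addTop, Or.inl trivial⟩
      · obtain ⟨b, hb, hbx⟩ := ih.2 x
        exact ⟨some b, hb.some_addTop, hbx⟩
  | @addBot α r _ ih =>
    refine ⟨?_, ?_⟩
    · rintro (_ | x)
      exacts [trivial, ih.1 x]
    · by_cases hchain : ∀ u v, r u v ∨ r v u
      · exact fun x => ⟨none, relBasic_none_addBot hchain, Or.inl trivial⟩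
      have lift {b : α} (hb : RelBasic r b) : RelBasic (addBotRel r) (some b) := by
        refine hb.some_addBot ?_
        by_contra! hmin
        refine hchain fun u v => ?_
        have hrefl := ih.1
        have hb₂ := hb.2.1 u v
        by_cases hu : u = b <;> by_cases hv : v = b <;> grind
      rintro (_ | x)
      · push Not at hchain
        obtain ⟨a, -⟩ := hchain
        obtain ⟨b, hb, -⟩ := ih.2 a
        exact ⟨some b, lift hb, Or.inr trivial⟩
      · obtain ⟨b, hb, hbx⟩ := ih.2 x
        exact ⟨some b, lift hb, hbx⟩
  | congr e he _ ih =>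
    refine ⟨?_, ?_⟩
    · exact e.forall_congr_right.mp fun a => (he a a).mp (ih.1 a)
    · refine e.forall_congr_right.mp fun a => ?_
      obtain ⟨b, hb, hba⟩ := ih.2 a
      exact ⟨e b, hb.map e he, by simpa only [he] using hba⟩

/-- In every nonempty (finite) `𝒱`-poset, every non-basic
element is comparable to at least one basic element. -/
theorem nonbasic_comparable_to_basic (α : Type) [PartialOrder α] [Fintype α]
    [Nonempty α] (h : IsVPoset α) (x : α) (hx : ¬IsBasic x) :
    ∃ b : α, IsBasic b ∧ (b ≤ x ∨ x ≤ b) := by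
  obtain ⟨b, hb, hbx⟩ := h.exists_relBasic.2 x
  exact ⟨b, (isBasic_iff_relBasic b).mpr hb, hbx⟩
end

section
/- Let P be a nonempty 𝒱-poset and let x be an element of P that is comparable to every basic element of P. Then the only maximal antichain of P containing x is the singleton {x}. -/
/-- `s` is a maximal antichain of a poset: an antichain that is not a proper
subset of another antichain. -/
def IsMaxAntichainSet {α : Type} [PartialOrder α] (s : Set α) : Prop :=
  IsAntichain (· ≤ ·) s ∧ ∀ t : Set α, IsAntichain (· ≤ ·) t → s ⊆ t → s = t

/-- Being a basic element, for an arbitrary relation `r` in place of `≤`. -/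
def IsBasicRel {α : Type} (r : α → α → Prop) (x : α) : Prop :=
  (∀ u v : α, u ≠ v → u ≠ x → v ≠ x → r u x → r v x → r u v ∨ r v u) ∧
  (∀ u v : α, u ≠ v → u ≠ x → v ≠ x → r x u → r x v → r u v ∨ r v u) ∧
  ∀ u : α, u ≠ x → r u x →
    ∃ w : α, w ≠ u ∧ w ≠ x ∧ ¬((r w u ↔ r w x) ∧ (r u w ↔ r x w))

namespace IsBasicRel

variable {α β : Type} {r : α → α → Prop} {s : β → β → Prop}

theorem isBasic [PartialOrder α] {x : α}
    (h : IsBasicRel (fun a b : α => a ≤ b) x) : IsBasic x := by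
  obtain ⟨h₁, h₂, h₃⟩ := h
  refine ⟨?_, ?_, ?_⟩
  · rintro ⟨u, v, huv, hu, hv⟩
    exact huv (h₁ u v (fun e => huv (Or.inl e.le)) hu.ne hv.ne hu.le hv.le)
  · rintro ⟨u, v, huv, hu, hv⟩
    exact huv (h₂ u v (fun e => huv (Or.inl e.le)) hu.ne' hv.ne' hu.le hv.le)
  · rintro ⟨u, hu, hw⟩
    obtain ⟨w, hwu, hwx, hne⟩ := h₃ u hu.ne hu.le
    exact hne (hw w hwu hwx)

theorem congr (e : α ≃ β) (he : ∀ a b : α, r a b ↔ s (e a) (e b)) {x : α}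
    (h : IsBasicRel r x) : IsBasicRel s (e x) := by
  simpa only [IsBasicRel, e.surjective.forall, e.surjective.exists, ← he, ne_eq,
    e.injective.eq_iff] using h

theorem sum_inl {x : α} (h : IsBasicRel r x) :
    IsBasicRel (sumRel r s) (Sum.inl x) := by
  simpa [IsBasicRel, Sum.forall, Sum.exists, sumRel] using h

theorem sum_inr {x : β} (h : IsBasicRel s x) :
    IsBasicRel (sumRel r s) (Sum.inr x) := by
  simpa [IsBasicRel, Sum.forall, Sum.exists, sumRel] using h

theorem addTop {x : α} (h : IsBasicRel r x) : IsBasicRel (addTopRel r) (some x) := by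
  simpa [IsBasicRel, Option.forall, Option.exists, addTopRel] using h

theorem addBot {x : α} (h : IsBasicRel r x) (hx : ∃ w, w ≠ x ∧ ¬r x w) :
    IsBasicRel (addBotRel r) (some x) := by
  obtain ⟨w, hw, hxw⟩ := hx
  simp [IsBasicRel, Option.forall, Option.exists, addBotRel] at h ⊢
  grind

theorem addBot_none {x : α} (h : IsBasicRel r x) (hx : ∀ w, w ≠ x → r x w) :
    IsBasicRel (addBotRel r) none := by
  have total : ∀ u v, u ≠ v → r u v ∨ r v u := by
    intro u v huv
    by_cases hu : u = x
    · exact Or.inl (hu ▸ hx v (hu ▸ huv.symm))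
    by_cases hv : v = x
    · exact Or.inr (hv ▸ hx u hu)
    exact h.2.1 u v huv hu hv (hx u hu) (hx v hv)
  simpa [IsBasicRel, Option.forall, addBotRel] using total

end IsBasicRel

theorem IsVRel.exists_isBasicRel {α : Type} {r : α → α → Prop} (h : IsVRel α r) :
    Nonempty α → ∃ x, IsBasicRel r x := by
  induction h with
  | empty α r h => exact fun hn => (not_isEmpty_iff.mpr hn h).elim
  | @union α β r s _ _ ihr ihs =>
    rintro ⟨a | b⟩
    · exact (ihr ⟨a⟩).elim fun x hx => ⟨_, hx.sum_inl⟩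
    · exact (ihs ⟨b⟩).elim fun x hx => ⟨_, hx.sum_inr⟩
  | @addTop α r _ ih =>
    intro _
    rcases isEmpty_or_nonempty α with hα | hα
    · exact ⟨none, by simp [IsBasicRel, Option.forall]⟩
    · exact (ih hα).elim fun x hx => ⟨_, hx.addTop⟩
  | @addBot α r _ ih =>
    intro _
    rcases isEmpty_or_nonempty α with hα | hα
    · exact ⟨none, by simp [IsBasicRel, Option.forall]⟩
    · obtain ⟨x, hx⟩ := ih hα
      by_cases hw : ∀ w, w ≠ x → r x w
      · exact ⟨_, hx.addBot_none hw⟩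
      · push Not at hw
        exact ⟨_, hx.addBot hw⟩
  | congr e he _ ih =>
    rintro ⟨b⟩
    exact (ih ⟨e.symm b⟩).elim fun x hx => ⟨_, hx.congr e he⟩

/-- An element which is incomparable to some element is incomparable to a basic one. -/
theorem IsVRel.exists_isBasicRel_incomparable {α : Type} {r : α → α → Prop}
    (h : IsVRel α r) :
    ∀ x y : α, x ≠ y → ¬r x y → ¬r y x →
      ∃ b, b ≠ x ∧ IsBasicRel r b ∧ ¬r x b ∧ ¬r b x := by
  induction h with
  | empty α r h => exact fun x => h.elim x
  | @union α β r s hr hs ihr ihs =>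
    rintro (x | x) (y | y) hne hxy hyx
    · obtain ⟨b, hb, hbasic, h₁, h₂⟩ := ihr x y (fun e => hne (e ▸ rfl)) hxy hyx
      exact ⟨_, fun e => hb (Sum.inl_injective e), hbasic.sum_inl, h₁, h₂⟩
    · obtain ⟨b, hb⟩ := hs.exists_isBasicRel ⟨y⟩
      exact ⟨_, Sum.inr_ne_inl, hb.sum_inr, id, id⟩
    · obtain ⟨b, hb⟩ := hr.exists_isBasicRel ⟨y⟩
      exact ⟨_, Sum.inl_ne_inr, hb.sum_inl, id, id⟩
    · obtain ⟨b, hb, hbasic, h₁, h₂⟩ := ihs x y (fun e => hne (e ▸ rfl)) hxy hyx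
      exact ⟨_, fun e => hb (Sum.inr_injective e), hbasic.sum_inr, h₁, h₂⟩
  | addTop _ ih =>
    rintro (_ | x) (_ | y) hne hxy hyx
    · exact (hne rfl).elim
    · exact (hyx trivial).elim
    · exact (hxy trivial).elim
    · obtain ⟨b, hb, hbasic, h₁, h₂⟩ := ih x y (fun e => hne (e ▸ rfl)) hxy hyx
      exact ⟨some b, fun e => hb (Option.some_injective _ e), hbasic.addTop, h₁, h₂⟩
  | addBot _ ih =>
    rintro (_ | x) (_ | y) hne hxy hyx
    · exact (hne rfl).elim
    · exact (hxy trivial).elim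
    · exact (hyx trivial).elim
    · obtain ⟨b, hb, hbasic, h₁, h₂⟩ := ih x y (fun e => hne (e ▸ rfl)) hxy hyx
      exact ⟨some b, fun e => hb (Option.some_injective _ e),
        hbasic.addBot ⟨x, hb.symm, h₂⟩, h₁, h₂⟩
  | congr e he _ ih =>
    simp only [e.surjective.forall, ← he, ne_eq, e.injective.eq_iff]
    intro x y hne hxy hyx
    obtain ⟨b, hb, hbasic, h₁, h₂⟩ := ih x y hne hxy hyx
    exact ⟨e b, fun h => hb (e.injective h), hbasic.congr e he,
      fun h => h₁ ((he _ _).mpr h), fun h => h₂ ((he _ _).mpr h)⟩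

/-- Let `P` be a nonempty (finite) `𝒱`-poset and let `x ∈ P` be
comparable to every basic element of `P`.  Then the only maximal antichain of `P`
containing `x` is `{x}`. -/
theorem maxAntichain_of_comparable_to_all_basic (α : Type) [PartialOrder α]
    [Fintype α] [Nonempty α] (h : IsVPoset α) (x : α)
    (hx : ∀ b : α, IsBasic b → x ≤ b ∨ b ≤ x)
    (A : Set α) (hA : IsMaxAntichainSet A) (hxA : x ∈ A) :
    A = {x} := by
  refine Set.eq_singleton_iff_unique_mem.mpr ⟨hxA, fun y hy => ?_⟩
  by_contra hne
  obtain ⟨b, -, hb, h₁, h₂⟩ := h.exists_isBasicRel_incomparable x y (Ne.symm hne)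
    (hA.1 hxA hy (Ne.symm hne)) (hA.1 hy hxA hne)
  exact (hx b hb.isBasic).elim h₁ h₂
end

section
/- For every nonempty 𝒱-poset P, Σ_{A∈𝒜(P)} 2^{b(A)} equals the number of antichains of P (including the empty antichain), where 𝒜(P) is the set of all maximal antichains of P and b(A) is the number of basic elements in A. -/
section Auxiliary

theorem setOf_sum_eq_image {α β : Type} {p : Set α → Prop} {q : Set β → Prop}
    {r : Set (α ⊕ β) → Prop}
    (h : ∀ A B, r (Sum.inl '' A ∪ Sum.inr '' B) ↔ p A ∧ q B) :
    {S | r S} = Set.sumEquiv.symm '' ({A | p A} ×ˢ {B | q B}) := by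
  ext S
  obtain ⟨⟨A, B⟩, rfl⟩ := Set.sumEquiv.symm.surjective S
  rw [Set.sumEquiv.symm.injective.mem_set_image]
  exact h A B

variable {α β : Type} [PartialOrder α] [PartialOrder β]

/-- The sum of `2 ^ b(A)` over all maximal antichains `A`. -/
noncomputable def maxAntichainSum (α : Type) [PartialOrder α] : ℕ :=
  ∑ᶠ A ∈ {A : Set α | IsMaxAntichainSet A}, 2 ^ {a ∈ A | IsBasic a}.ncard

/-- The number of antichains. -/
noncomputable def antichainCount (α : Type) [PartialOrder α] : ℕ :=
  {s : Set α | IsAntichain (· ≤ ·) s}.ncard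

theorem isMaxAntichainSet_iff {s : Set α} :
    IsMaxAntichainSet s ↔ IsAntichain (· ≤ ·) s ∧ ∀ x, ∃ a ∈ s, a ≤ x ∨ x ≤ a := by
  refine and_congr_right fun hs => ⟨fun h x => ?_, fun h t ht hst => ?_⟩
  · by_contra! hx
    have hins : IsAntichain (· ≤ ·) (insert x s) :=
      hs.insert (fun b hb _ => (hx b hb).1) (fun b hb _ => (hx b hb).2)
    have hxs : x ∈ s := h _ hins (Set.subset_insert x s) ▸ Set.mem_insert x s
    exact (hx x hxs).1 le_rfl
  · refine hst.antisymm fun x hx => ?_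
    obtain ⟨a, ha, hax | hxa⟩ := h x
    · exact ht.eq (hst ha) hx hax ▸ ha
    · exact ht.eq hx (hst ha) hxa ▸ ha

theorem isAntichain_image_iff (e : α ↪o β) {s : Set α} :
    IsAntichain (· ≤ ·) (e '' s) ↔ IsAntichain (· ≤ ·) s := by
  simp only [IsAntichain, Set.Pairwise, Set.forall_mem_image, Pi.compl_apply, e.le_iff_le,
    e.injective.ne_iff, ne_eq]

theorem ncard_basic_image {e : α → β} (he : Function.Injective e)
    (hb : ∀ x, IsBasic (e x) ↔ IsBasic x) (s : Set α) :
    {a ∈ e '' s | IsBasic a}.ncard = {a ∈ s | IsBasic a}.ncard := by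
  rw [← Set.ncard_image_of_injective _ he]
  congr 1
  ext y
  constructor
  · rintro ⟨⟨x, hx, rfl⟩, hy⟩
    exact ⟨x, ⟨hx, (hb x).1 hy⟩, rfl⟩
  · rintro ⟨x, ⟨hx, hxb⟩, rfl⟩
    exact ⟨⟨x, hx, rfl⟩, (hb x).2 hxb⟩

section OrderIso

theorem isBasic_orderIso (e : α ≃o β) (x : α) : IsBasic (e x) ↔ IsBasic x := by
  simp only [IsBasic, Incomp, e.surjective.exists, e.surjective.forall, e.lt_iff_lt,
    e.le_iff_le, e.injective.ne_iff, ne_eq]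

theorem isMaxAntichainSet_image_orderIso (e : α ≃o β) (s : Set α) :
    IsMaxAntichainSet (e '' s) ↔ IsMaxAntichainSet s := by
  simp only [isMaxAntichainSet_iff, Set.exists_mem_image, e.surjective.forall, e.le_iff_le]
  exact and_congr_left fun _ => isAntichain_image_iff e.toOrderEmbedding

theorem antichainCount_congr (e : α ≃o β) : antichainCount α = antichainCount β := by
  unfold antichainCount
  rw [← Set.ncard_image_of_injective _ e.injective.image_injective]
  congr 1
  ext t
  obtain ⟨s, rfl⟩ := e.surjective.image_surjective t
  rw [e.injective.image_injective.mem_set_image]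
  exact (isAntichain_image_iff e.toOrderEmbedding).symm

theorem maxAntichainSum_congr (e : α ≃o β) : maxAntichainSum α = maxAntichainSum β := by
  have himage : {A : Set β | IsMaxAntichainSet A}
      = (e '' ·) '' {A : Set α | IsMaxAntichainSet A} := by
    ext t
    obtain ⟨s, rfl⟩ := e.surjective.image_surjective t
    rw [e.injective.image_injective.mem_set_image]
    exact isMaxAntichainSet_image_orderIso e s
  unfold maxAntichainSum
  rw [himage, finsum_mem_image e.injective.image_injective.injOn]
  simp only [ncard_basic_image e.injective (isBasic_orderIso e)]

end OrderIso

section DisjointUnion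

theorem isAntichain_sum_iff {A : Set α} {B : Set β} :
    IsAntichain (· ≤ ·) (Sum.inl '' A ∪ Sum.inr '' B)
      ↔ IsAntichain (· ≤ ·) A ∧ IsAntichain (· ≤ ·) B := by
  simp [IsAntichain, Set.Pairwise, Sum.forall]

theorem isMaxAntichainSet_sum_iff {A : Set α} {B : Set β} :
    IsMaxAntichainSet (Sum.inl '' A ∪ Sum.inr '' B)
      ↔ IsMaxAntichainSet A ∧ IsMaxAntichainSet B := by
  simp only [isMaxAntichainSet_iff, isAntichain_sum_iff]
  simp [Sum.forall, Sum.exists]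
  tauto

theorem isBasic_inl (x : α) : IsBasic (Sum.inl x : α ⊕ β) ↔ IsBasic x := by
  simp [IsBasic, Incomp, Sum.forall, Sum.exists]

theorem isBasic_inr (x : β) : IsBasic (Sum.inr x : α ⊕ β) ↔ IsBasic x := by
  simp [IsBasic, Incomp, Sum.forall, Sum.exists]

theorem ncard_basic_sum [Finite α] [Finite β] (A : Set α) (B : Set β) :
    {a ∈ (Sum.inl '' A ∪ Sum.inr '' B : Set (α ⊕ β)) | IsBasic a}.ncard
      = {a ∈ A | IsBasic a}.ncard + {b ∈ B | IsBasic b}.ncard := by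
  rw [← ncard_basic_image Sum.inl_injective (isBasic_inl (β := β)) A,
    ← ncard_basic_image Sum.inr_injective (isBasic_inr (α := α)) B,
    ← Set.ncard_union_eq]
  · congr 1
    ext x
    exact or_and_right
  · rw [Set.disjoint_left]
    rintro _ ⟨⟨a, -, rfl⟩, -⟩ ⟨⟨b, -, h⟩, -⟩
    cases h

theorem antichainCount_sum : antichainCount (α ⊕ β) = antichainCount α * antichainCount β := by
  unfold antichainCount
  rw [setOf_sum_eq_image fun _ _ => isAntichain_sum_iff,
    Set.ncard_image_of_injective _ Set.sumEquiv.symm.injective, Set.ncard_prod]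

theorem maxAntichainSum_sum [Finite α] [Finite β] :
    maxAntichainSum (α ⊕ β) = maxAntichainSum α * maxAntichainSum β := by
  unfold maxAntichainSum
  rw [setOf_sum_eq_image fun _ _ => isMaxAntichainSet_sum_iff,
    finsum_mem_image Set.sumEquiv.symm.injective.injOn,
    finsum_mem_eq_finite_toFinset_sum _ (Set.toFinite {A : Set α | IsMaxAntichainSet A}),
    finsum_mem_eq_finite_toFinset_sum _ (Set.toFinite {A : Set β | IsMaxAntichainSet A}),
    Finset.sum_mul_sum, ← Finset.sum_product',
    finsum_mem_eq_finite_toFinset_sum _ (Set.toFinite _)]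
  refine Finset.sum_congr (by ext; simp) fun p _ => ?_
  rw [← pow_add, ← ncard_basic_sum]
  rfl

end DisjointUnion

section Adjoin

variable {e : α ↪o β} {t : β}

theorem eq_or_mem_range (hrange : Set.range e = {t}ᶜ) (y : β) : y = t ∨ ∃ x, e x = y := by
  by_cases hy : y = t
  · exact Or.inl hy
  · exact Or.inr (hrange.symm ▸ hy : y ∈ Set.range e)

theorem isAntichain_adjoin_iff (hrange : Set.range e = {t}ᶜ) (ht : ∀ x, e x < t ∨ t < e x)
    {S : Set β} :
    IsAntichain (· ≤ ·) S ↔ S = {t} ∨ ∃ A : Set α, IsAntichain (· ≤ ·) A ∧ e '' A = S := by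
  constructor
  · intro hS
    by_cases htS : t ∈ S
    · refine Or.inl (Set.eq_singleton_iff_unique_mem.2 ⟨htS, fun y hy => ?_⟩)
      rcases eq_or_mem_range hrange y with h | ⟨x, rfl⟩
      · exact h
      · rcases ht x with h | h
        · exact hS.eq hy htS h.le
        · exact (hS.eq htS hy h.le).symm
    · have himage : e '' (e ⁻¹' S) = S := by
        rw [Set.image_preimage_eq_iff, hrange]
        exact fun y hy h => htS (h ▸ hy)
      exact Or.inr ⟨e ⁻¹' S, (isAntichain_image_iff e).1 (himage.symm ▸ hS), himage⟩
  · rintro (rfl | ⟨A, hA, rfl⟩)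
    · exact Set.pairwise_singleton _ _
    · exact (isAntichain_image_iff e).2 hA

theorem isMaxAntichainSet_adjoin_iff [Nonempty α] (hrange : Set.range e = {t}ᶜ)
    (ht : ∀ x, e x < t ∨ t < e x) {S : Set β} :
    IsMaxAntichainSet S ↔ S = {t} ∨ ∃ A : Set α, IsMaxAntichainSet A ∧ e '' A = S := by
  simp only [isMaxAntichainSet_iff]
  constructor
  · rintro ⟨hS, hmax⟩
    obtain h | ⟨A, hA, rfl⟩ := (isAntichain_adjoin_iff hrange ht).1 hS
    · exact Or.inl h
    · refine Or.inr ⟨A, ⟨hA, fun x => ?_⟩, rfl⟩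
      simpa only [Set.exists_mem_image, e.le_iff_le] using hmax (e x)
  · rintro (rfl | ⟨A, ⟨hA, hmax⟩, rfl⟩)
    · refine ⟨Set.pairwise_singleton _ _, fun y => ⟨t, rfl, ?_⟩⟩
      rcases eq_or_mem_range hrange y with rfl | ⟨x, rfl⟩
      · exact Or.inl le_rfl
      · exact (ht x).symm.imp le_of_lt le_of_lt
    · refine ⟨(isAntichain_image_iff e).2 hA, fun y => ?_⟩
      simp only [Set.exists_mem_image]
      rcases eq_or_mem_range hrange y with rfl | ⟨x, rfl⟩
      · obtain ⟨a, ha, -⟩ := hmax (Classical.arbitrary α)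
        exact ⟨a, ha, (ht a).imp le_of_lt le_of_lt⟩
      · simpa only [e.le_iff_le] using hmax x

theorem singleton_ne_image (hrange : Set.range e = {t}ᶜ) (A : Set α) : e '' A ≠ {t} := by
  intro h
  obtain ⟨x, -, hx⟩ : t ∈ e '' A := h ▸ Set.mem_singleton t
  exact (hrange ▸ Set.mem_range_self x : e x ∈ ({t} : Set β)ᶜ) hx

theorem antichainCount_adjoin [Finite α] (hrange : Set.range e = {t}ᶜ)
    (ht : ∀ x, e x < t ∨ t < e x) : antichainCount β = antichainCount α + 1 := by
  have hset : {S : Set β | IsAntichain (· ≤ ·) S}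
      = insert {t} ((e '' ·) '' {A : Set α | IsAntichain (· ≤ ·) A}) := by
    ext S
    exact isAntichain_adjoin_iff hrange ht
  unfold antichainCount
  rw [hset, Set.ncard_insert_of_notMem _ (Set.toFinite _),
    Set.ncard_image_of_injective _ e.injective.image_injective]
  rintro ⟨A, -, hA⟩
  exact singleton_ne_image hrange A hA

theorem maxAntichainSum_adjoin [Finite α] [Nonempty α] (hrange : Set.range e = {t}ᶜ)
    (ht : ∀ x, e x < t ∨ t < e x) (htb : ¬IsBasic t) (hb : ∀ x, IsBasic (e x) ↔ IsBasic x) :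
    maxAntichainSum β = maxAntichainSum α + 1 := by
  have hset : {S : Set β | IsMaxAntichainSet S}
      = insert {t} ((e '' ·) '' {A : Set α | IsMaxAntichainSet A}) := by
    ext S
    exact isMaxAntichainSet_adjoin_iff hrange ht
  have hempty : {a ∈ ({t} : Set β) | IsBasic a} = ∅ := by
    rw [Set.eq_empty_iff_forall_notMem]
    rintro _ ⟨rfl, h⟩
    exact htb h
  unfold maxAntichainSum
  rw [hset, finsum_mem_insert _ _ (Set.toFinite _),
    finsum_mem_image e.injective.image_injective.injOn, hempty, Set.ncard_empty, pow_zero,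
    add_comm]
  · simp only [ncard_basic_image e.injective hb]
  · rintro ⟨A, -, hA⟩
    exact singleton_ne_image hrange A hA

theorem Incomp.map {u v : α} (h : Incomp u v) (e : α ↪o β) : Incomp (e u) (e v) := by
  simpa only [Incomp, e.le_iff_le] using h

theorem exists_incomp_adjoin_iff (hrange : Set.range e = {t}ᶜ) (ht : ∀ x, e x < t ∨ t < e x)
    (p : β → Prop) :
    (∃ u v, Incomp u v ∧ p u ∧ p v) ↔ ∃ u v, Incomp u v ∧ p (e u) ∧ p (e v) := by
  constructor
  · rintro ⟨u, v, huv, hu, hv⟩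
    rcases eq_or_mem_range hrange u with rfl | ⟨u, rfl⟩
    · rcases eq_or_mem_range hrange v with rfl | ⟨v, rfl⟩
      · exact (huv (Or.inl le_rfl)).elim
      · exact (huv ((ht v).symm.imp le_of_lt le_of_lt)).elim
    · rcases eq_or_mem_range hrange v with rfl | ⟨v, rfl⟩
      · exact (huv ((ht u).imp le_of_lt le_of_lt)).elim
      · refine ⟨u, v, ?_, hu, hv⟩
        simpa only [Incomp, e.le_iff_le] using huv
  · rintro ⟨u, v, huv, hu, hv⟩
    exact ⟨e u, e v, huv.map e, hu, hv⟩

theorem isBasic_adjoin_iff (hinc : ∃ u v : α, Incomp u v) (hrange : Set.range e = {t}ᶜ)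
    (ht : (∀ x, e x < t) ∨ ∀ x, t < e x) (x : α) : IsBasic (e x) ↔ IsBasic x := by
  have hcomp : ∀ x, e x < t ∨ t < e x := fun x => ht.imp (· x) (· x)
  have hne : ∀ x, t ≠ e x := fun x => (hcomp x).elim ne_of_gt ne_of_lt
  have hforall : ∀ p : β → Prop, (∀ y, p y) ↔ p t ∧ ∀ x, p (e x) := fun p =>
    ⟨fun h => ⟨h t, fun x => h (e x)⟩, fun h y => by
      rcases eq_or_mem_range hrange y with rfl | ⟨x, rfl⟩
      exacts [h.1, h.2 x]⟩
  unfold IsBasic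
  rw [exists_incomp_adjoin_iff hrange hcomp (· < e x),
    exists_incomp_adjoin_iff hrange hcomp (e x < ·)]
  simp only [e.lt_iff_lt]
  refine and_congr_right fun _ => and_congr_right fun hB2 => not_congr ?_
  constructor
  · rintro ⟨u, hux, hu⟩
    rcases eq_or_mem_range hrange u with rfl | ⟨u, rfl⟩
    · have hbot : ∀ y, u < e y := ht.resolve_left fun h => lt_asymm hux (h x)
      have hmin : ∀ w, w ≠ x → x < w := fun w hw =>
        lt_of_le_of_ne (e.le_iff_le.1 (((hu (e w) (hne w).symm (e.injective.ne hw)).2).1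
          (hbot w).le)) hw.symm
      obtain ⟨a, b, hab⟩ := hinc
      refine (hB2 ⟨a, b, hab, hmin a ?_, hmin b ?_⟩).elim
      · rintro rfl
        by_cases hba : b = a
        · exact hab (Or.inl hba.ge)
        · exact hab (Or.inl (hmin b hba).le)
      · rintro rfl
        by_cases hba : a = b
        · exact hab (Or.inl hba.le)
        · exact hab (Or.inr (hmin a hba).le)
    · refine ⟨u, e.lt_iff_lt.1 hux, fun w hwu hwx => ?_⟩
      simpa only [e.le_iff_le] using hu (e w) (e.injective.ne hwu) (e.injective.ne hwx)
  · rintro ⟨u, hux, hu⟩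
    refine ⟨e u, e.lt_iff_lt.2 hux, (hforall _).2 ⟨fun _ _ => ?_, fun w hwu hwx => ?_⟩⟩
    · rcases ht with h | h
      · exact ⟨iff_of_false (h u).not_ge (h x).not_ge, iff_of_true (h u).le (h x).le⟩
      · exact ⟨iff_of_true (h u).le (h x).le, iff_of_false (h u).not_ge (h x).not_ge⟩
    · simpa only [e.le_iff_le] using
        hu w (fun h => hwu (congrArg e h)) (fun h => hwx (congrArg e h))

theorem not_isBasic_adjoin (hinc : ∃ u v : α, Incomp u v)
    (ht : (∀ x, e x < t) ∨ ∀ x, t < e x) : ¬IsBasic t := by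
  obtain ⟨u, v, huv⟩ := hinc
  rintro ⟨hB1, hB2, -⟩
  rcases ht with h | h
  · exact hB1 ⟨e u, e v, huv.map e, h u, h v⟩
  · exact hB2 ⟨e u, e v, huv.map e, h u, h v⟩

end Adjoin

section Chain

theorem isBasic_iff_isBot_of_total [Finite α] (htot : ∀ u v : α, ¬Incomp u v) (x : α) :
    IsBasic x ↔ IsBot x := by
  have hle : ∀ u v : α, u ≤ v ∨ v ≤ u := fun u v => not_not.1 (htot u v)
  constructor
  · rintro ⟨-, -, hB3⟩
    by_contra hx
    obtain ⟨y, hy⟩ := not_forall.1 hx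
    have hyx : y < x := lt_of_le_not_ge ((hle x y).resolve_left hy) hy
    obtain ⟨u, hux, hmax⟩ := (Set.toFinite (Set.Iio x)).exists_maximal ⟨y, hyx⟩
    refine hB3 ⟨u, hux, fun w hwu hwx => ⟨⟨fun h => h.trans hux.le, fun h => ?_⟩,
      ⟨fun h => ?_, fun h => hux.le.trans h⟩⟩⟩
    · exact (hle w u).elim id (hmax (lt_of_le_of_ne h hwx))
    · refine (hle x w).elim id fun h' => ?_
      exact (hwu ((hmax (lt_of_le_of_ne h' hwx) h).antisymm h)).elim
  · intro hx
    exact ⟨fun ⟨u, v, huv, _⟩ => htot u v huv, fun ⟨u, v, huv, _⟩ => htot u v huv,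
      fun ⟨u, hu, _⟩ => (hx u).not_gt hu⟩

theorem isAntichain_iff_of_total (htot : ∀ u v : α, ¬Incomp u v) {s : Set α} :
    IsAntichain (· ≤ ·) s ↔ s = ∅ ∨ ∃ x, {x} = s := by
  constructor
  · intro hs
    rcases s.eq_empty_or_nonempty with h | ⟨x, hx⟩
    · exact Or.inl h
    · refine Or.inr ⟨x, (Set.eq_singleton_iff_unique_mem.2 ⟨hx, fun y hy => ?_⟩).symm⟩
      rcases not_not.1 (htot x y) with h | h
      · exact (hs.eq hx hy h).symm
      · exact hs.eq hy hx h
  · rintro (rfl | ⟨x, rfl⟩)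
    · exact Set.pairwise_empty _
    · exact Set.pairwise_singleton _ _

theorem isMaxAntichainSet_iff_of_total [Nonempty α] (htot : ∀ u v : α, ¬Incomp u v)
    {s : Set α} : IsMaxAntichainSet s ↔ ∃ x, {x} = s := by
  rw [isMaxAntichainSet_iff, isAntichain_iff_of_total htot]
  constructor
  · rintro ⟨rfl | h, hmax⟩
    · obtain ⟨a, ha, -⟩ := hmax (Classical.arbitrary α)
      exact ha.elim
    · exact h
  · rintro ⟨x, rfl⟩
    exact ⟨Or.inr ⟨x, rfl⟩, fun y => ⟨x, rfl, not_not.1 (htot x y)⟩⟩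

theorem maxAntichainSum_eq_of_total [Finite α] [Nonempty α] (htot : ∀ u v : α, ¬Incomp u v) :
    maxAntichainSum α = antichainCount α := by
  classical
  have : Fintype α := Fintype.ofFinite α
  have hcount : antichainCount α = Fintype.card α + 1 := by
    have hset : {s : Set α | IsAntichain (· ≤ ·) s}
        = insert ∅ (Set.range fun x : α => ({x} : Set α)) := by
      ext s
      exact isAntichain_iff_of_total htot
    unfold antichainCount
    rw [hset, Set.ncard_insert_of_notMem (by simp) (Set.toFinite _), ← Set.image_univ,
      Set.ncard_image_of_injective _ Set.singleton_injective, Set.ncard_univ,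
      Nat.card_eq_fintype_card]
  obtain ⟨m, -, hm⟩ := (Set.finite_univ (α := α)).exists_minimal Set.univ_nonempty
  have hbot : IsBot m := fun y => (not_not.1 (htot m y)).elim id (hm trivial)
  have hweight : ∀ x : α, 2 ^ {a ∈ ({x} : Set α) | IsBasic a}.ncard
      = 1 + if x = m then 1 else 0 := by
    intro x
    by_cases hx : x = m
    · subst hx
      have hb : {a ∈ ({x} : Set α) | IsBasic a} = {x} := by
        ext a
        refine ⟨fun h => h.1, fun h => ⟨h, ?_⟩⟩
        rw [Set.mem_singleton_iff.1 h]
        exact (isBasic_iff_isBot_of_total htot x).2 hbot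
      rw [hb, Set.ncard_singleton, if_pos rfl, pow_one]
    · have hb : {a ∈ ({x} : Set α) | IsBasic a} = ∅ := by
        rw [Set.eq_empty_iff_forall_notMem]
        rintro _ ⟨rfl, ha⟩
        exact hx ((((isBasic_iff_isBot_of_total htot _).1 ha) m).antisymm (hbot _))
      rw [hb, Set.ncard_empty, if_neg hx, pow_zero, add_zero]
  have hset : {s : Set α | IsMaxAntichainSet s} = Set.range fun x : α => ({x} : Set α) := by
    ext s
    exact isMaxAntichainSet_iff_of_total htot
  unfold maxAntichainSum
  rw [hset, finsum_mem_range Set.singleton_injective, finsum_eq_sum_of_fintype, hcount,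
    Finset.sum_congr rfl fun x _ => hweight x]
  simp [Finset.sum_add_distrib]

end Chain

theorem maxAntichainSum_eq_adjoin [Finite α] {e : α ↪o β} {t : β}
    (hrange : Set.range e = {t}ᶜ) (ht : (∀ x, e x < t) ∨ ∀ x, t < e x)
    (h : maxAntichainSum α = antichainCount α) :
    maxAntichainSum β = antichainCount β := by
  have hcomp : ∀ x, e x < t ∨ t < e x := fun x => ht.imp (· x) (· x)
  by_cases hinc : ∃ u v : α, Incomp u v
  · have : Nonempty α := ⟨hinc.choose⟩
    rw [maxAntichainSum_adjoin hrange hcomp (not_isBasic_adjoin hinc ht)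
      (isBasic_adjoin_iff hinc hrange ht), antichainCount_adjoin hrange hcomp, h]
  · have : Nonempty β := ⟨t⟩
    have : Finite β := by
      refine Set.finite_univ_iff.1 (((Set.finite_range e).insert t).subset fun y _ => ?_)
      exact eq_or_mem_range hrange y
    refine maxAntichainSum_eq_of_total fun u v huv => hinc ?_
    obtain ⟨a, b, hab, -⟩ := (exists_incomp_adjoin_iff hrange hcomp fun _ => True).1
      ⟨u, v, huv, trivial, trivial⟩
    exact ⟨a, b, hab⟩

theorem maxAntichainSum_eq_of_isEmpty [IsEmpty α] : maxAntichainSum α = antichainCount α := by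
  have hmax : {s : Set α | IsMaxAntichainSet s} = {∅} := by
    ext s
    simp [Set.eq_empty_of_isEmpty s, isMaxAntichainSet_iff]
  have hanti : {s : Set α | IsAntichain (· ≤ ·) s} = {∅} := by
    ext s
    simp [Set.eq_empty_of_isEmpty s]
  rw [maxAntichainSum, antichainCount, hmax, hanti]
  simp

end Auxiliary

theorem IsVRel.exists_partialOrder {α : Type} {r : α → α → Prop} (h : IsVRel α r) :
    ∃ _ : PartialOrder α, (∀ a b : α, a ≤ b ↔ r a b) ∧ Finite α ∧
      maxAntichainSum α = antichainCount α := by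
  induction h with
  | empty α r h =>
    let inst : PartialOrder α :=
      { le := r
        le_refl := fun a => isEmptyElim a
        le_trans := fun a => isEmptyElim a
        le_antisymm := fun a => isEmptyElim a }
    exact ⟨inst, fun _ _ => Iff.rfl, inferInstance, maxAntichainSum_eq_of_isEmpty⟩
  | @union α β r s _ _ ih₁ ih₂ =>
    obtain ⟨_, hr, _, h₁⟩ := ih₁
    obtain ⟨_, hs, _, h₂⟩ := ih₂
    refine ⟨(inferInstance : PartialOrder (α ⊕ β)), ?_, inferInstance, ?_⟩
    · rintro (a | a) (b | b) <;> simp [sumRel, hr, hs]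
    · rw [maxAntichainSum_sum, antichainCount_sum, h₁, h₂]
  | @addTop α r _ ih =>
    obtain ⟨_, hr, _, h⟩ := ih
    have hle : ∀ a b : WithTop α, a ≤ b ↔ addTopRel r a b := by
      rintro (_ | a) (_ | b)
      · exact iff_of_true (le_refl (⊤ : WithTop α)) trivial
      · exact iff_of_false (WithTop.not_top_le_coe b) id
      · exact iff_of_true (le_top : (a : WithTop α) ≤ ⊤) trivial
      · exact WithTop.coe_le_coe.trans (hr a b)
    have hrange : Set.range (WithTop.coeOrderHom : α ↪o WithTop α) = {⊤}ᶜ :=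
      WithTop.range_coe.trans (by ext; simp [lt_top_iff_ne_top])
    have heq : maxAntichainSum (WithTop α) = antichainCount (WithTop α) :=
      maxAntichainSum_eq_adjoin hrange (Or.inl WithTop.coe_lt_top) h
    exact ⟨(inferInstance : PartialOrder (WithTop α)), hle, inferInstanceAs (Finite (Option α)),
      heq⟩
  | @addBot α r _ ih =>
    obtain ⟨_, hr, _, h⟩ := ih
    have hle : ∀ a b : WithBot α, a ≤ b ↔ addBotRel r a b := by
      rintro (_ | a) (_ | b)
      · exact iff_of_true (le_refl (⊥ : WithBot α)) trivial
      · exact iff_of_true (bot_le : (⊥ : WithBot α) ≤ b) trivial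
      · exact iff_of_false (WithBot.not_coe_le_bot a) id
      · exact WithBot.coe_le_coe.trans (hr a b)
    have hrange : Set.range (WithBot.coeOrderHom : α ↪o WithBot α) = {⊥}ᶜ :=
      WithBot.range_coe.trans (by ext; simp [bot_lt_iff_ne_bot])
    have heq : maxAntichainSum (WithBot α) = antichainCount (WithBot α) :=
      maxAntichainSum_eq_adjoin hrange (Or.inr WithBot.bot_lt_coe) h
    exact ⟨(inferInstance : PartialOrder (WithBot α)), hle, inferInstanceAs (Finite (Option α)),
      heq⟩
  | @congr α β r s e he _ ih =>
    obtain ⟨_, hr, _, h⟩ := ih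
    let inst : PartialOrder β := PartialOrder.lift e.symm e.symm.injective
    let f : α ≃o β := ⟨e, fun {a b} => by
      change e.symm (e a) ≤ e.symm (e b) ↔ a ≤ b
      simp⟩
    refine ⟨inst, fun a b => ?_, Finite.of_equiv α e, ?_⟩
    · change e.symm a ≤ e.symm b ↔ s a b
      rw [hr, he, e.apply_symm_apply, e.apply_symm_apply]
    · rw [← maxAntichainSum_congr f, ← antichainCount_congr f, h]

/-- For every nonempty (finite) `𝒱`-poset `P`, the sum of
`2^{b(A)}` over all maximal antichains `A` of `P` — where `b(A)` is the number of
basic elements in `A` — equals the number of antichains of `P` (including the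
empty antichain). -/
theorem sum_two_pow_basic_eq_card_antichains (α : Type) [PartialOrder α]
    [Fintype α] [Nonempty α] (h : IsVPoset α) :
    ∑ᶠ A ∈ {A : Set α | IsMaxAntichainSet A}, 2 ^ {a ∈ A | IsBasic a}.ncard
      = {s : Set α | IsAntichain (· ≤ ·) s}.ncard := by
  obtain ⟨inst, hle, -, heq⟩ := IsVRel.exists_partialOrder h
  obtain rfl := PartialOrder.ext hle
  exact heq
end

section
/- A finite poset P is a 𝒱-poset if and only if it contains neither an induced N-poset nor an induced bowtie; equivalently, if and only if there are no four elements u,v,w,x of P such that u>w, u>x, v>x, u and v are incomparable, and w and x are incomparable. -/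
/-- A relation is `NBowtieFree` if it has no four elements `u, v, w, x` with `w, x` below `u`,
`x` below `v`, and neither `u, v` nor `w, x` comparable. -/
def NBowtieFree {α : Type} (r : α → α → Prop) : Prop :=
  ∀ ⦃u v w x : α⦄, r w u → r x u → r x v → ¬r u v → ¬r v u → ¬r w x → r x w

theorem IsVRel.nBowtieFree {α : Type} {r : α → α → Prop} (h : IsVRel α r) :
    NBowtieFree r := by
  induction h with
  | empty α r h => exact fun u => h.elim u
  | union _ _ ihr ihs =>
    rintro (u | u) (v | v) (w | w) (x | x) <;> simp only [sumRel] <;>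
      first | exact @ihr u v w x | exact @ihs u v w x | tauto
  | addTop _ ih =>
    rintro (_ | u) (_ | v) (_ | w) (_ | x) <;> simp only [addTopRel] <;>
      first | exact @ih u v w x | tauto
  | addBot _ ih =>
    rintro (_ | u) (_ | v) (_ | w) (_ | x) <;> simp only [addBotRel] <;>
      first | exact @ih u v w x | tauto
  | congr e he _ ih =>
    intro u v w x
    obtain ⟨u, rfl⟩ := e.surjective u
    obtain ⟨v, rfl⟩ := e.surjective v
    obtain ⟨w, rfl⟩ := e.surjective w
    obtain ⟨x, rfl⟩ := e.surjective x
    simp only [← he]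
    exact @ih u v w x

section PartialOrder

variable {α : Type} [PartialOrder α]

/-- A nonempty finite poset without induced `N`-posets and bowties has a greatest element or a
least element, or it splits into two nonempty parts without comparabilities between them. -/
theorem exists_isTop_or_isBot_or_disconnected [Finite α] [Nonempty α]
    (h : NBowtieFree (α := α) (· ≤ ·)) :
    (∃ t : α, IsTop t) ∨ (∃ b : α, IsBot b) ∨
      ∃ p : α → Prop, (∃ a, p a) ∧ (∃ a, ¬p a) ∧ ∀ a b, a ≤ b → (p a ↔ p b) := by
  have above (a : α) : ∃ m, a ≤ m ∧ IsMax m := by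
    obtain ⟨m, hm, hmax⟩ := Finite.exists_le_maximal (p := fun _ : α => True) (a := a) trivial
    exact ⟨m, hm, fun b hb => hmax.le_of_ge trivial hb⟩
  have below (a : α) : ∃ m, m ≤ a ∧ IsMin m := by
    obtain ⟨m, hm, hmin⟩ := Finite.exists_le_minimal (p := fun _ : α => True) (a := a) trivial
    exact ⟨m, hm, fun b hb => hmin.le_of_le trivial hb⟩
  by_cases hx : ∃ x u v : α, IsMin x ∧ IsMax u ∧ IsMax v ∧ u ≠ v ∧ x ≤ u ∧ x ≤ v
  · obtain ⟨x, u, v, hx, hu, hv, huv, hxu, hxv⟩ := hx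
    refine Or.inr ?_
    by_cases hbot : IsBot x
    · exact Or.inl ⟨x, hbot⟩
    refine Or.inr ⟨(x ≤ ·), ⟨x, le_rfl⟩, by simpa [IsBot] using hbot,
      fun a b hab => ⟨fun ha => ha.trans hab, fun hb => ?_⟩⟩
    obtain ⟨m, hbm, hm⟩ := above b
    obtain ⟨m', hm', hne, hxm'⟩ : ∃ m', IsMax m' ∧ m' ≠ m ∧ x ≤ m' := by
      by_cases hum : u = m
      · exact ⟨v, hv, fun e => huv (hum.trans e.symm), hxv⟩
      · exact ⟨u, hu, hum, hxu⟩
    by_cases hax : a ≤ x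
    · exact hx hax
    · exact h (hab.trans hbm) (hb.trans hbm) hxm' (fun e => hne (hm.eq_of_le e).symm)
        (fun e => hne (hm'.eq_of_le e)) hax
  · push Not at hx
    obtain ⟨m, -, hm⟩ := above (Classical.arbitrary α)
    by_cases htop : IsTop m
    · exact Or.inl ⟨m, htop⟩
    refine Or.inr (Or.inr ⟨(· ≤ m), ⟨m, le_rfl⟩, by simpa [IsTop] using htop,
      fun a b hab => ⟨fun ha => ?_, fun hb => hab.trans hb⟩⟩)
    obtain ⟨x, hxa, hx'⟩ := below a
    obtain ⟨m', hbm', hm'⟩ := above b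
    by_contra hbm
    exact hx x m m' hx' hm hm' (fun e => hbm (e ▸ hbm')) (hxa.trans ha)
      ((hxa.trans hab).trans hbm')

theorem NBowtieFree.subtype (h : NBowtieFree (α := α) (· ≤ ·)) (p : α → Prop) :
    NBowtieFree (α := {a // p a}) (· ≤ ·) :=
  fun u v w x => @h u v w x

theorem isVPoset_of_isTop {t : α} (ht : IsTop t) (h : IsVPoset {a // a ≠ t}) :
    IsVPoset α := by
  classical
  refine .congr (Equiv.optionSubtypeNe t) ?_ (.addTop h)
  rintro (_ | a) (_ | b)
  · simp [addTopRel]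
  · simpa [addTopRel] using fun e => b.2 ((ht b).antisymm e)
  · simpa [addTopRel] using ht a
  · simp [addTopRel]

theorem isVPoset_of_isBot {t : α} (ht : IsBot t) (h : IsVPoset {a // a ≠ t}) :
    IsVPoset α := by
  classical
  refine .congr (Equiv.optionSubtypeNe t) ?_ (.addBot h)
  rintro (_ | a) (_ | b)
  · simp [addBotRel]
  · simpa [addBotRel] using ht b
  · simpa [addBotRel] using fun e => a.2 (e.antisymm (ht a))
  · simp [addBotRel]

theorem isVPoset_of_disconnected {p : α → Prop} (hp : ∀ a b, a ≤ b → (p a ↔ p b))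
    (h : IsVPoset {a // p a}) (h' : IsVPoset {a // ¬p a}) : IsVPoset α := by
  classical
  refine .congr (Equiv.sumCompl p) ?_ (.union h h')
  rintro (a | a) (b | b)
  · simp [sumRel]
  · simpa [sumRel] using fun e => b.2 ((hp _ _ e).1 a.2)
  · simpa [sumRel] using fun e => a.2 ((hp _ _ e).2 b.2)
  · simp [sumRel]

theorem NBowtieFree.isVPoset {α : Type} [PartialOrder α] [Finite α]
    (h : NBowtieFree (α := α) (· ≤ ·)) : IsVPoset α := by
  induction hn : Nat.card α using Nat.strong_induction_on generalizing α with
  | _ n ih =>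
    subst hn
    have sub (p : α → Prop) (hp : ∃ a, ¬p a) : IsVPoset {a // p a} :=
      ih _ (hp.elim fun _ => Finite.card_subtype_lt) (h.subtype p) rfl
    cases isEmpty_or_nonempty α with
    | inl hα => exact .empty _ _ hα
    | inr hα =>
      obtain ⟨t, ht⟩ | ⟨b, hb⟩ | ⟨p, ⟨a, ha⟩, hnp, hp⟩ :=
        exists_isTop_or_isBot_or_disconnected h
      · exact isVPoset_of_isTop ht (sub _ ⟨t, by simp⟩)
      · exact isVPoset_of_isBot hb (sub _ ⟨b, by simp⟩)
      · exact isVPoset_of_disconnected hp (sub _ hnp) (sub _ ⟨a, not_not_intro ha⟩)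

theorem isVPoset_iff_nBowtieFree [Finite α] :
    IsVPoset α ↔ NBowtieFree (α := α) (· ≤ ·) :=
  ⟨IsVRel.nBowtieFree, NBowtieFree.isVPoset⟩

theorem nBowtieFree_iff_not_exists :
    NBowtieFree (α := α) (· ≤ ·) ↔
      ¬∃ u v w x : α, w < u ∧ x < u ∧ x < v ∧ Incomp u v ∧ Incomp w x := by
  constructor
  · rintro h ⟨u, v, w, x, hwu, hxu, hxv, huv, hwx⟩
    rw [Incomp, not_or] at huv hwx
    exact hwx.2 (h hwu.le hxu.le hxv.le huv.1 huv.2 hwx.1)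
  · intro h u v w x hwu hxu hxv huv hvu hwx
    by_contra hxw
    refine h ⟨u, v, w, x, hwu.lt_of_ne ?_, hxu.lt_of_ne ?_, hxv.lt_of_ne ?_,
      not_or.2 ⟨huv, hvu⟩, not_or.2 ⟨hwx, hxw⟩⟩
    · rintro rfl; exact hxw hxu
    · rintro rfl; exact huv hxv
    · rintro rfl; exact hvu hxu

theorem exists_N_or_bowtie_iff :
    ((∃ u v w x : α, w < u ∧ x < u ∧ x < v ∧ Incomp u v ∧ Incomp w x ∧ Incomp w v) ∨
      (∃ u v w x : α, w < u ∧ x < u ∧ w < v ∧ x < v ∧ Incomp u v ∧ Incomp w x)) ↔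
      ∃ u v w x : α, w < u ∧ x < u ∧ x < v ∧ Incomp u v ∧ Incomp w x := by
  constructor
  · rintro (⟨u, v, w, x, hwu, hxu, hxv, huv, hwx, -⟩ | ⟨u, v, w, x, hwu, hxu, -, hxv, huv, hwx⟩) <;>
      exact ⟨u, v, w, x, hwu, hxu, hxv, huv, hwx⟩
  · rintro ⟨u, v, w, x, hwu, hxu, hxv, huv, hwx⟩
    have hvw : ¬v ≤ w := fun hvw => huv (.inr (hvw.trans hwu.le))
    by_cases hwv : w ≤ v
    · exact .inr ⟨u, v, w, x, hwu, hxu, lt_of_le_not_ge hwv hvw, hxv, huv, hwx⟩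
    · exact .inl ⟨u, v, w, x, hwu, hxu, hxv, huv, hwx, not_or.2 ⟨hwv, hvw⟩⟩

end PartialOrder

/-- A finite poset is a `𝒱`-poset if and only if it contains
neither an induced `N`-poset (four elements `u, v, w, x` whose only strict
relations are `u > w`, `u > x`, `v > x`) nor an induced bowtie (four elements
`u, v, w, x` whose only strict relations are `u > w`, `u > x`, `v > w`, `v > x`);
equivalently, if and only if there are no four elements `u, v, w, x` with
`u > w`, `u > x`, `v > x`, `u, v` incomparable and `w, x` incomparable. -/
theorem isVPoset_iff_N_free_and_bowtie_free (α : Type) [PartialOrder α]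
    [Fintype α] :
    (IsVPoset α ↔
      ¬((∃ u v w x : α,
            w < u ∧ x < u ∧ x < v ∧ Incomp u v ∧ Incomp w x ∧ Incomp w v) ∨
        (∃ u v w x : α,
            w < u ∧ x < u ∧ w < v ∧ x < v ∧ Incomp u v ∧ Incomp w x))) ∧
    (IsVPoset α ↔
      ¬∃ u v w x : α, w < u ∧ x < u ∧ x < v ∧ Incomp u v ∧ Incomp w x) := by
  rw [exists_N_or_bowtie_iff, ← nBowtieFree_iff_not_exists]
  exact ⟨isVPoset_iff_nBowtieFree, isVPoset_iff_nBowtieFree⟩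
end
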